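/- For every T ≥ 1, the function (x_1,…,x_T) ↦ q_T(k, x) converges uniformly on [0,1]^T, as k → 1⁻, to the function x ↦ Σ_{i=1}^T Π_{j=1}^i (1 − x_{T−j+1}). Consequently the persistent change filter D(k, ·) converges uniformly on [0,1]^T, as k → 1⁻, to D⁽²⁾(x) = Σ_{i=1}^T Π_{j=1}^i x_{T−j+1} − Σ_{i=1}^T Π_{j=1}^i (1 − x_{T−j+1}). -/

import Mathlib

/-- `pRec k x t` is the recursion `p₁ = x₁`, `p_{τ+1} = (1 + k (x_{τ+1} − 1)) p_τ + x_{τ+1}`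
(with the harmless convention `p₀ = 0`, which makes the recursion also produce `p₁ = x₁`). -/
noncomputable def pRec (k : ℝ) (x : ℕ → ℝ) : ℕ → ℝ
  | 0 => 0
  | t + 1 => (1 + k * (x (t + 1) - 1)) * pRec k x t + x (t + 1)

/-- `qRec k x t` is the recursion `q₁ = 1 − x₁`, `q_{τ+1} = (1 − k x_{τ+1}) q_τ + (1 − x_{τ+1})`. -/
noncomputable def qRec (k : ℝ) (x : ℕ → ℝ) : ℕ → ℝ
  | 0 => 0
  | t + 1 => (1 - k * x (t + 1)) * qRec k x t + (1 - x (t + 1))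

/-- The persistent change filter `D(k, x) = p_T − q_T`. -/
noncomputable def Dfilter (k : ℝ) (x : ℕ → ℝ) (T : ℕ) : ℝ :=
  pRec k x T - qRec k x T

/-- `D⁰(x) = Σ_{i=1}^T Π_{j=1}^i x_{T−j+1}`. -/
noncomputable def D0 (T : ℕ) (x : ℕ → ℝ) : ℝ :=
  ∑ i ∈ Finset.Icc 1 T, ∏ j ∈ Finset.Icc 1 i, x (T - j + 1)

theorem D0_succ (T : ℕ) (y : ℕ → ℝ) : D0 (T + 1) y = y (T + 1) * (1 + D0 T y) := by
  have prod_shift (i : ℕ) : ∏ j ∈ Finset.Icc 1 (i + 1), y (T + 1 - j + 1) =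
      y (T + 1) * ∏ j ∈ Finset.Icc 1 i, y (T - j + 1) := by
    rw [← Finset.mul_prod_Ioc_eq_prod_Icc (Nat.le_add_left 1 i), Nat.add_sub_cancel,
      ← Finset.Icc_add_one_left_eq_Ioc, ← Finset.map_add_right_Icc 1 i 1, Finset.prod_map]
    simp
  rw [D0, ← Finset.add_sum_Ioc_eq_sum_Icc (Nat.le_add_left 1 T),
    ← Finset.Icc_add_one_left_eq_Ioc, ← Finset.map_add_right_Icc 1 T 1, Finset.sum_map]
  simp only [addRightEmbedding_apply, prod_shift, ← Finset.mul_sum]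
  simp [D0, mul_add]

/-- The recursion `qRec` is `pRec` applied to the complementary sequence. -/
theorem qRec_eq_pRec (k : ℝ) (x : ℕ → ℝ) (t : ℕ) :
    qRec k x t = pRec k (fun τ => 1 - x τ) t := by
  induction t with
  | zero => rfl
  | succ t ih => rw [qRec, pRec, ih]; ring

theorem pRec_mem_Icc {k : ℝ} (hk : k ∈ Set.Icc (0 : ℝ) 1) {y : ℕ → ℝ} {t : ℕ}
    (hy : ∀ τ ∈ Finset.Icc 1 t, y τ ∈ Set.Icc (0 : ℝ) 1) :
    pRec k y t ∈ Set.Icc (0 : ℝ) t := by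
  induction t with
  | zero => simp [pRec]
  | succ t ih =>
    obtain ⟨h0, h1⟩ := ih fun τ hτ => hy τ (Finset.Icc_subset_Icc_right t.le_succ hτ)
    obtain ⟨hy0, hy1⟩ := hy (t + 1) (by simp)
    have hc0 : 0 ≤ 1 + k * (y (t + 1) - 1) := by nlinarith [hk.1, hk.2]
    have hc1 : 1 + k * (y (t + 1) - 1) ≤ 1 := by nlinarith [hk.1, hk.2]
    rw [pRec]
    push_cast
    exact ⟨by positivity, by nlinarith⟩

theorem pRec_sub_D0_mem_Icc {k : ℝ} (hk : k ∈ Set.Icc (0 : ℝ) 1) {y : ℕ → ℝ} {t : ℕ}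
    (hy : ∀ τ ∈ Finset.Icc 1 t, y τ ∈ Set.Icc (0 : ℝ) 1) :
    pRec k y t - D0 t y ∈ Set.Icc 0 ((1 - k) * (t : ℝ) ^ 2) := by
  induction t with
  | zero => simp [pRec, D0]
  | succ t ih =>
    have hy' : ∀ τ ∈ Finset.Icc 1 t, y τ ∈ Set.Icc (0 : ℝ) 1 :=
      fun τ hτ => hy τ (Finset.Icc_subset_Icc_right t.le_succ hτ)
    obtain ⟨h0, h1⟩ := ih hy'
    obtain ⟨hp0, hp1⟩ := pRec_mem_Icc hk hy'
    obtain ⟨hy0, hy1⟩ := hy (t + 1) (by simp)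
    have hk1 : 0 ≤ 1 - k := sub_nonneg.2 hk.2
    have hz0 : 0 ≤ 1 - y (t + 1) := sub_nonneg.2 hy1
    have step : pRec k y (t + 1) - D0 (t + 1) y =
        y (t + 1) * (pRec k y t - D0 t y) + (1 - k) * ((1 - y (t + 1)) * pRec k y t) := by
      rw [pRec, D0_succ]; ring
    have hfst : y (t + 1) * (pRec k y t - D0 t y) ≤ (1 - k) * (t : ℝ) ^ 2 :=
      (mul_le_of_le_one_left h0 hy1).trans h1
    have hsnd : (1 - k) * ((1 - y (t + 1)) * pRec k y t) ≤ (1 - k) * t :=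
      mul_le_mul_of_nonneg_left
        ((mul_le_of_le_one_left hp0 (by linarith)).trans hp1) hk1
    rw [step]
    push_cast
    refine ⟨by positivity, ?_⟩
    nlinarith [mul_nonneg hk1 (Nat.cast_nonneg (α := ℝ) t)]

/-- As k -> 1-, q_T(k, .) converges uniformly on [0,1]^T to the sum of products of (1 - x),
and consequently D(k, .) converges uniformly to D2(x). -/
theorem qRec_Dfilter_tendstoUniformly (T : ℕ) (hT : 1 ≤ T) :
    (∀ ε : ℝ, 0 < ε → ∃ δ : ℝ, 0 < δ ∧
      ∀ k : ℝ, k ∈ Set.Icc (0 : ℝ) 1 → 1 - k < δ →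
        ∀ x : ℕ → ℝ, (∀ τ ∈ Finset.Icc 1 T, x τ ∈ Set.Icc (0 : ℝ) 1) →
          |qRec k x T -
            ∑ i ∈ Finset.Icc 1 T, ∏ j ∈ Finset.Icc 1 i, (1 - x (T - j + 1))| < ε) ∧
    (∀ ε : ℝ, 0 < ε → ∃ δ : ℝ, 0 < δ ∧
      ∀ k : ℝ, k ∈ Set.Icc (0 : ℝ) 1 → 1 - k < δ →
        ∀ x : ℕ → ℝ, (∀ τ ∈ Finset.Icc 1 T, x τ ∈ Set.Icc (0 : ℝ) 1) →
          |Dfilter k x T -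
            ((∑ i ∈ Finset.Icc 1 T, ∏ j ∈ Finset.Icc 1 i, x (T - j + 1)) -
             (∑ i ∈ Finset.Icc 1 T, ∏ j ∈ Finset.Icc 1 i, (1 - x (T - j + 1))))| < ε) := by
  have hT2 : (0 : ℝ) < (T : ℝ) ^ 2 := by positivity
  have compl_mem {x : ℕ → ℝ} (hx : ∀ τ ∈ Finset.Icc 1 T, x τ ∈ Set.Icc (0 : ℝ) 1) :
      ∀ τ ∈ Finset.Icc 1 T, 1 - x τ ∈ Set.Icc (0 : ℝ) 1 :=
    fun τ hτ => ⟨sub_nonneg.2 (hx τ hτ).2, sub_le_self 1 (hx τ hτ).1⟩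
  refine ⟨fun ε hε => ⟨ε / (T : ℝ) ^ 2, by positivity, fun k hk hkδ x hx => ?_⟩,
    fun ε hε => ⟨ε / (T : ℝ) ^ 2, by positivity, fun k hk hkδ x hx => ?_⟩⟩
  · rw [lt_div_iff₀ hT2] at hkδ
    obtain ⟨hq0, hq1⟩ := pRec_sub_D0_mem_Icc hk (compl_mem hx)
    rw [← qRec_eq_pRec, D0] at hq0 hq1
    rw [abs_lt]
    constructor <;> linarith
  · rw [lt_div_iff₀ hT2] at hkδ
    obtain ⟨hp0, hp1⟩ := pRec_sub_D0_mem_Icc hk hx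
    obtain ⟨hq0, hq1⟩ := pRec_sub_D0_mem_Icc hk (compl_mem hx)
    rw [← qRec_eq_pRec, D0] at hq0 hq1
    rw [D0] at hp0 hp1
    rw [Dfilter, abs_lt]
    constructor <;> linarith
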